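/- Let l_1,…,l_r ∈ ℤ_+ and x_1,…,x_r ∈ ℚ(q), and let ε′ = ε_{M|0} = (0^M) be the subsequence of ε consisting of its zero entries. If M is sufficiently large and the U(ε′)-module W_{l_1,ε′}(x_1) ⊗ … ⊗ W_{l_r,ε′}(x_r) is irreducible, then the U(ε)-module W_{l_1,ε}(x_1) ⊗ … ⊗ W_{l_r,ε}(x_r) is also irreducible. -/

import Mathlib

/-! Generalized quantum group of affine type A (Kwon–Yu), common definitions.

Conventions:
* The base field is `K = ℚ(q)` with `qq = q`.
* The index set `𝕀 = {1,…,n}` is modeled 0-based by `Fin n`: the position `p : Fin n`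
  represents the letter `p+1`; `ε : Fin n → Bool` with `ε p = true` meaning `ε_{p+1} = 1`.
* The affine index set `I = {0,1,…,n-1}` is modeled by `Fin n` (with cyclic arithmetic);
  for `i : Fin n`, the simple root is `α_i = δ_i - δ_{i+1}` (letters mod n), whose
  letters have 0-based positions `i - 1` and `i` (`Fin` subtraction is cyclic).
-/

set_option synthInstance.maxHeartbeats 1000000
set_option maxHeartbeats 1600000

noncomputable section
open scoped TensorProduct

abbrev K : Type := RatFunc ℚ

/-- The indeterminate `q`. -/
def qq : K := RatFunc.X

/-- `q_p = (-1)^{ε_p} q^{(-1)^{ε_p}}` for the letter at (0-based) position `p`. -/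
def qv {n : ℕ} (ε : Fin n → Bool) (p : Fin n) : K := if ε p then -qq⁻¹ else qq

/-- `(-1)^{ε_p}` as an integer. -/
def sgn {n : ℕ} (ε : Fin n → Bool) (p : Fin n) : ℤ := if ε p then -1 else 1

/-- `⟨α_i, δ_{p+1}^∨⟩`, where `i ∈ I` and `p` is a 0-based letter position. -/
def apair {n : ℕ} [NeZero n] (i p : Fin n) : ℤ :=
  (if p = i - 1 then 1 else 0) - (if p = i then 1 else 0)

/-- the exponent of `ω_{p+1} = q^{(-1)^{ε_{p+1}} δ_{p+1}^∨}` as an element of `P^∨ = ℤ^n`. -/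
def ωexp {n : ℕ} (ε : Fin n → Bool) (p : Fin n) : Fin n → ℤ :=
  fun r => if r = p then sgn ε p else 0

/-- the exponent of `k_i = ω_i ω_{i+1}^{-1}` in `P^∨`. -/
def κe {n : ℕ} [NeZero n] (ε : Fin n → Bool) (i : Fin n) : Fin n → ℤ :=
  ωexp ε (i - 1) - ωexp ε i

/-- `D_{ij} = q_i^{⟨α_j,δ_i^∨⟩} q_{i+1}^{-⟨α_j,δ_{i+1}^∨⟩}`. -/
def Dc {n : ℕ} [NeZero n] (ε : Fin n → Bool) (i j : Fin n) : K :=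
  qv ε (i - 1) ^ apair j (i - 1) * qv ε i ^ (-apair j i)

/-- `[2] = q + q⁻¹`. -/
def brk2 : K := qq + qq⁻¹

/-- `i ∈ I_odd`, i.e. `(α_i|α_i) = 0`, i.e. `ε_i ≠ ε_{i+1}`. -/
def oddI {n : ℕ} [NeZero n] (ε : Fin n → Bool) (i : Fin n) : Prop := ε (i - 1) ≠ ε i

/-- `(-1)^{ε_i}` for `i ∈ I`, as a scalar. -/
def signI {n : ℕ} [NeZero n] (ε : Fin n → Bool) (i : Fin n) : K := if ε (i - 1) then -1 else 1

/-- cyclic adjacency in the affine Dynkin diagram of `I = ℤ/n`. -/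
def adjI {n : ℕ} [NeZero n] (i j : Fin n) : Prop := j = i + 1 ∨ i = j + 1

/-! ### The fundamental-type modules `W_{s,ε}(x)` and their tensor products, concretely.

`W_{s,ε}(x)` is modeled inside the ambient coefficient space `WA n = (Fin n → ℕ) → K` as the
span `Wspan n ε s` of the basis vectors `|m⟩ = Pi.single m 1` for `m ∈ ℤ_+^n(ε)` with
`|m| = s`.  The generators act by the explicit formulas of Section 4.1 of Kwon–Yu. -/

/-- A linear endomorphism of a coefficient space given by two shift terms. -/
def shift2 {M : Type} (c₁ c₂ : M → K) (σ₁ σ₂ : M → M) : Module.End K (M → K) where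
  toFun g := fun m => c₁ m * g (σ₁ m) + c₂ m * g (σ₂ m)
  map_add' g h := by funext m; simp only [Pi.add_apply]; ring
  map_smul' a g := by
    funext m; simp only [Pi.smul_apply, smul_eq_mul, RingHom.id_apply]; ring

abbrev WA (n : ℕ) : Type := (Fin n → ℕ) → K

/-- `ℤ_+^n(ε)` with `|m| = s`. -/
def MsetP (n : ℕ) (ε : Fin n → Bool) (s : ℕ) : Set (Fin n → ℕ) :=
  {m | (∀ p, ε p = true → m p ≤ 1) ∧ ∑ p, m p = s}

/-- The subspace `W_{s,ε} ⊆ WA n`. -/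
def Wspan (n : ℕ) (ε : Fin n → Bool) (s : ℕ) : Submodule K (WA n) :=
  Submodule.span K {g | ∃ m ∈ MsetP n ε s, g = Pi.single m 1}

/-- `[k] = (q^k - q^{-k})/(q - q⁻¹)`. -/
def brk (k : ℕ) : K := (qq ^ (k : ℤ) - qq ^ (-(k : ℤ))) / (qq - qq⁻¹)

/-- `e_i`-coefficient, written from the *output* index `m`: the matrix entry of `e_i`
between `|m - e_i + e_{i+1}⟩` and `|m⟩`. -/
def cE {n : ℕ} [NeZero n] (ε : Fin n → Bool) (x : K) (i : Fin n) (m : Fin n → ℕ) : K :=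
  if 1 ≤ m (i - 1) ∧ (ε (i - 1) = true → m (i - 1) = 1) then
    (if i = 0 then x else 1) * qq ^ ((m i : ℤ) - (m (i - 1) : ℤ) + 1) * brk (m i + 1)
  else 0

/-- the source index of `e_i` from the output index: `m - e_i + e_{i+1}` (letterwise). -/
def σE {n : ℕ} [NeZero n] (i : Fin n) (m : Fin n → ℕ) : Fin n → ℕ :=
  Function.update (Function.update m (i - 1) (m (i - 1) - 1)) i (m i + 1)

/-- `f_i`-coefficient from the output index `m`. -/
def cF {n : ℕ} [NeZero n] (ε : Fin n → Bool) (x : K) (i : Fin n) (m : Fin n → ℕ) : K :=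
  if 1 ≤ m i ∧ (ε i = true → m i = 1) then
    (if i = 0 then x⁻¹ else 1) * qq ^ ((m (i - 1) : ℤ) - (m i : ℤ) + 1) * brk (m (i - 1) + 1)
  else 0

/-- the source index of `f_i` from the output index: `m + e_i - e_{i+1}`. -/
def σF {n : ℕ} [NeZero n] (i : Fin n) (m : Fin n → ℕ) : Fin n → ℕ :=
  Function.update (Function.update m (i - 1) (m (i - 1) + 1)) i (m i - 1)

/-- eigenvalue of `q^h` on `|m⟩`. -/
def qhW {n : ℕ} (ε : Fin n → Bool) (h : Fin n → ℤ) (m : Fin n → ℕ) : K :=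
  ∏ p : Fin n, qv ε p ^ (sgn ε p * h p * (m p : ℤ))

/-- eigenvalue of `k_i` on `|m⟩`. -/
def kW {n : ℕ} [NeZero n] (ε : Fin n → Bool) (i : Fin n) (m : Fin n → ℕ) : K :=
  qv ε (i - 1) ^ ((m (i - 1) : ℤ)) * qv ε i ^ (-(m i : ℤ))

/-- eigenvalue of `k_i⁻¹` on `|m⟩`. -/
def kinvW {n : ℕ} [NeZero n] (ε : Fin n → Bool) (i : Fin n) (m : Fin n → ℕ) : K :=
  qv ε (i - 1) ^ (-(m (i - 1) : ℤ)) * qv ε i ^ ((m i : ℤ))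

/-- the action of `e_i` on `W_{s,ε}(x)` (on the ambient space `WA n`). -/
def eWop (n : ℕ) [NeZero n] (ε : Fin n → Bool) (x : K) (i : Fin n) : Module.End K (WA n) :=
  shift2 (cE ε x i) 0 (σE i) id

/-- the action of `f_i` on `W_{s,ε}(x)`. -/
def fWop (n : ℕ) [NeZero n] (ε : Fin n → Bool) (x : K) (i : Fin n) : Module.End K (WA n) :=
  shift2 (cF ε x i) 0 (σF i) id

/-- the action of `q^h` on `W_{s,ε}(x)`. -/
def qhWop (n : ℕ) (ε : Fin n → Bool) (h : Fin n → ℤ) : Module.End K (WA n) :=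
  shift2 (qhW ε h) 0 id id

/-! #### Tensor products `W_{l,ε}(x) ⊗ W_{m,ε}(y)`, modeled on
`PW n = ((Fin n → ℕ) × (Fin n → ℕ)) → K`, with the comultiplication
`Δ(e_i) = e_i ⊗ 1 + k_i^{-1} ⊗ e_i`, `Δ(f_i) = f_i ⊗ k_i + 1 ⊗ f_i`, `Δ(q^h) = q^h ⊗ q^h`,
and the opposite comultiplication `Δ^op`. -/

abbrev PW (n : ℕ) : Type := ((Fin n → ℕ) × (Fin n → ℕ)) → K

def PairSpan (n : ℕ) (ε : Fin n → Bool) (l m : ℕ) : Submodule K (PW n) :=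
  Submodule.span K
    {g | ∃ m₁ ∈ MsetP n ε l, ∃ m₂ ∈ MsetP n ε m, g = Pi.single (m₁, m₂) 1}

/-- `Δ(e_i)` on `W_{·,ε}(x) ⊗ W_{·,ε}(y)`. -/
def ePair (n : ℕ) [NeZero n] (ε : Fin n → Bool) (x y : K) (i : Fin n) : Module.End K (PW n) :=
  shift2 (fun p => cE ε x i p.1) (fun p => kinvW ε i p.1 * cE ε y i p.2)
    (fun p => (σE i p.1, p.2)) (fun p => (p.1, σE i p.2))

/-- `Δ(f_i)`. -/
def fPair (n : ℕ) [NeZero n] (ε : Fin n → Bool) (x y : K) (i : Fin n) : Module.End K (PW n) :=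
  shift2 (fun p => cF ε x i p.1 * kW ε i p.2) (fun p => cF ε y i p.2)
    (fun p => (σF i p.1, p.2)) (fun p => (p.1, σF i p.2))

/-- `Δ(q^h)`. -/
def qhPair (n : ℕ) (ε : Fin n → Bool) (h : Fin n → ℤ) : Module.End K (PW n) :=
  shift2 (fun p => qhW ε h p.1 * qhW ε h p.2) 0 id id

/-- `Δ^op(e_i) = 1 ⊗ e_i + e_i ⊗ k_i^{-1}`. -/
def ePairOp (n : ℕ) [NeZero n] (ε : Fin n → Bool) (x y : K) (i : Fin n) : Module.End K (PW n) :=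
  shift2 (fun p => cE ε y i p.2) (fun p => cE ε x i p.1 * kinvW ε i p.2)
    (fun p => (p.1, σE i p.2)) (fun p => (σE i p.1, p.2))

/-- `Δ^op(f_i) = k_i ⊗ f_i + f_i ⊗ 1`. -/
def fPairOp (n : ℕ) [NeZero n] (ε : Fin n → Bool) (x y : K) (i : Fin n) : Module.End K (PW n) :=
  shift2 (fun p => kW ε i p.1 * cF ε y i p.2) (fun p => cF ε x i p.1)
    (fun p => (p.1, σF i p.2)) (fun p => (σF i p.1, p.2))

/-- the flip `P(a ⊗ b) = b ⊗ a` on `PW n`. -/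
def Pflip (n : ℕ) : Module.End K (PW n) where
  toFun g := fun p => g (p.2, p.1)
  map_add' g h := by funext m; simp
  map_smul' a g := by funext m; simp

/-- the basis vector `|s e_{p+1}⟩` (all boxes at the letter position `p`). -/
def unitM (n : ℕ) (s : ℕ) (p : Fin n) : Fin n → ℕ := fun r => if r = p then s else 0

/-- number of `0`s in `ε`. -/
def Mcount {n : ℕ} (ε : Fin n → Bool) : ℕ := (Finset.univ.filter fun p => ε p = false).card
/-- number of `1`s in `ε`. -/
def Ncount {n : ℕ} (ε : Fin n → Bool) : ℕ := (Finset.univ.filter fun p => ε p = true).card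

/-- the one-row partition `(s)` is an `(M|N)`-hook partition. -/
def hookRow {n : ℕ} (ε : Fin n → Bool) (s : ℕ) : Prop :=
  Mcount ε = 0 → s ≤ Ncount ε

/-! #### `r`-fold tensor products `W_{l₁,ε}(x₁) ⊗ ⋯ ⊗ W_{l_r,ε}(x_r)`, modeled on
`VrW n r = (Fin r → (Fin n → ℕ)) → K`, with the iterated comultiplication
`Δ^{(r)}(e_i) = Σ_t k_i^{-1} ⊗ ⋯ ⊗ k_i^{-1} ⊗ e_i ⊗ 1 ⊗ ⋯ ⊗ 1` etc. -/

abbrev VrW (n r : ℕ) : Type := (Fin r → (Fin n → ℕ)) → K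

def eWr (n r : ℕ) [NeZero n] (ε : Fin n → Bool) (x : Fin r → K) (i : Fin n) :
    Module.End K (VrW n r) :=
  ∑ t : Fin r, shift2 0
    (fun μ => (∏ s ∈ Finset.univ.filter (fun s => s < t), kinvW ε i (μ s)) * cE ε (x t) i (μ t))
    id (fun μ => Function.update μ t (σE i (μ t)))

def fWr (n r : ℕ) [NeZero n] (ε : Fin n → Bool) (x : Fin r → K) (i : Fin n) :
    Module.End K (VrW n r) :=
  ∑ t : Fin r, shift2 0
    (fun μ => cF ε (x t) i (μ t) * ∏ s ∈ Finset.univ.filter (fun s => t < s), kW ε i (μ s))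
    id (fun μ => Function.update μ t (σF i (μ t)))

def qhWr (n r : ℕ) (ε : Fin n → Bool) (h : Fin n → ℤ) : Module.End K (VrW n r) :=
  shift2 (fun μ => ∏ t : Fin r, qhW ε h (μ t)) 0 id id

/-- the subspace `W_{l₁,ε}(x₁) ⊗ ⋯ ⊗ W_{l_r,ε}(x_r) ⊆ VrW n r`. -/
def RSpan (n r : ℕ) (ε : Fin n → Bool) (l : Fin r → ℕ) : Submodule K (VrW n r) :=
  Submodule.span K {g | ∃ μ : Fin r → (Fin n → ℕ), (∀ t, μ t ∈ MsetP n ε (l t)) ∧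
    g = Pi.single μ 1}

/-- irreducibility of `W_{l₁,ε}(x₁) ⊗ ⋯ ⊗ W_{l_r,ε}(x_r)` as a `U(ε)`-module. -/
def WtensorIrred (n r : ℕ) [NeZero n] (ε : Fin n → Bool) (l : Fin r → ℕ) (x : Fin r → K) :
    Prop :=
  RSpan n r ε l ≠ ⊥ ∧
  ∀ N : Submodule K (VrW n r), N ≤ RSpan n r ε l →
    (∀ i : Fin n, ∀ v ∈ N, eWr n r ε x i v ∈ N ∧ fWr n r ε x i v ∈ N) →
    (∀ h : Fin n → ℤ, ∀ v ∈ N, qhWr n r ε h v ∈ N) →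
    N = ⊥ ∨ N = RSpan n r ε l

/-! ### Combinatorics of single-box moves -/

/-- move one box from `a` to `b`. -/
def mv {n : ℕ} (a b : Fin n) (m : Fin n → ℕ) : Fin n → ℕ :=
  Function.update (Function.update m a (m a - 1)) b (m b + 1)

theorem mv_apply {n : ℕ} (a b : Fin n) (hab : a ≠ b) (m : Fin n → ℕ) (p : Fin n) :
    mv a b m p = if p = b then m b + 1 else if p = a then m a - 1 else m p := by
  unfold mv
  simp only [Function.update_apply]

def AdjF {n : ℕ} (a b : Fin n) : Prop := a.val + 1 = b.val ∨ b.val + 1 = a.val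

def StepW {n : ℕ} (w w' : Fin n → ℕ) : Prop :=
  ∃ a b : Fin n, AdjF a b ∧ 1 ≤ w a ∧ w b = 0 ∧ w' = mv a b w

def ReachW {n : ℕ} : (Fin n → ℕ) → (Fin n → ℕ) → Prop := Relation.ReflTransGen StepW

theorem AdjF.ne {n : ℕ} {a b : Fin n} (h : AdjF a b) : a ≠ b := by
  rintro rfl
  unfold AdjF at h
  omega

theorem jumpW {n : ℕ} (d : ℕ) : ∀ (p z : Fin n) (w : Fin n → ℕ),
    (p.val + d + 1 = z.val ∨ z.val + d + 1 = p.val) → 1 ≤ w p → w z = 0 →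
    (∀ y : Fin n, (p < y ∧ y < z ∨ z < y ∧ y < p) → w y ≤ 1) →
    ReachW w (mv p z w) := by
  induction d with
  | zero =>
    intro p z w hd hp hz _
    exact Relation.ReflTransGen.single ⟨p, z, by unfold AdjF; omega, hp, hz, rfl⟩
  | succ d ih =>
    intro p z w hd hp hz hb
    obtain ⟨y, hy, hyz, hbet⟩ : ∃ y : Fin n, AdjF p y ∧
        (y.val + d + 1 = z.val ∨ z.val + d + 1 = y.val) ∧ (p < y ∧ y < z ∨ z < y ∧ y < p) := by
      rcases hd with hd | hd
      · refine ⟨⟨p.val + 1, by omega⟩, Or.inl rfl, Or.inl ?_, Or.inl ⟨?_, ?_⟩⟩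
        · show p.val + 1 + d + 1 = z.val
          omega
        · show p.val < p.val + 1
          omega
        · show p.val + 1 < z.val
          omega
      · refine ⟨⟨p.val - 1, by omega⟩, Or.inr ?_, Or.inr ?_, Or.inr ⟨?_, ?_⟩⟩
        · show p.val - 1 + 1 = p.val
          omega
        · show z.val + d + 1 = p.val - 1
          omega
        · show z.val < p.val - 1
          omega
        · show p.val - 1 < p.val
          omega
    have hpy : p ≠ y := hy.ne
    have hpz : p ≠ z := by rintro rfl; omega
    have hyz' : y ≠ z := by rintro rfl; omega
    have hbet' : ∀ u : Fin n, (y < u ∧ u < z ∨ z < u ∧ u < y) →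
        (p < u ∧ u < z ∨ z < u ∧ u < p) ∧ u ≠ p ∧ u ≠ y := by
      intro u hu
      have h1 : ∀ a b : Fin n, a < b ↔ a.val < b.val := fun a b => Iff.rfl
      simp only [h1, ne_eq, Fin.ext_iff] at *
      omega
    have hy1 := hb y hbet
    rcases Nat.eq_zero_or_pos (w y) with h0 | h0
    · have s1 : StepW w (mv p y w) := ⟨p, y, hy, hp, h0, rfl⟩
      have s2 := ih y z (mv p y w) hyz (by simp [mv_apply _ _ hpy])
        (by simp [mv_apply _ _ hpy, hyz'.symm, hpz.symm, hz]) (by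
          intro u hu
          obtain ⟨h1, h2, h3⟩ := hbet' u hu
          simp only [mv_apply _ _ hpy, h2, h3, if_false]
          exact hb u h1)
      have e : mv y z (mv p y w) = mv p z w := by
        funext u
        simp only [mv_apply _ _ hpy, mv_apply _ _ hpz, mv_apply _ _ hyz']
        grind
      rw [e] at s2
      exact Relation.ReflTransGen.head s1 s2
    · have s1 := ih y z w hyz h0 hz (fun u hu => hb u (hbet' u hu).1)
      have s2 : StepW (mv y z w) (mv p y (mv y z w)) :=
        ⟨p, y, hy, by simp [mv_apply _ _ hyz', hpz, hpy, hp],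
          by simp [mv_apply _ _ hyz', hyz']; omega, rfl⟩
      have e : mv p y (mv y z w) = mv p z w := by
        funext u
        simp only [mv_apply _ _ hpy, mv_apply _ _ hpz, mv_apply _ _ hyz']
        grind
      rw [e] at s2
      exact Relation.ReflTransGen.tail s1 s2

theorem jumpW' {n : ℕ} (p z : Fin n) (w : Fin n → ℕ) (hp : 1 ≤ w p) (hz : w z = 0)
    (hb : ∀ y : Fin n, (p < y ∧ y < z ∨ z < y ∧ y < p) → w y ≤ 1) :
    ReachW w (mv p z w) := by
  have hne : p ≠ z := by rintro rfl; omega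
  have h1 : p.val ≠ z.val := fun h => hne (Fin.ext h)
  rcases Nat.lt_or_gt_of_ne h1 with h | h
  · exact jumpW (z.val - p.val - 1) p z w (by omega) hp hz hb
  · exact jumpW (p.val - z.val - 1) p z w (by omega) hp hz hb

theorem sum_mv {n : ℕ} (a b : Fin n) (hab : a ≠ b) (w : Fin n → ℕ) (ha : 1 ≤ w a) :
    ∑ p, mv a b w p = ∑ p, w p := by
  have h : ∀ p, mv a b w p + (if p = a then 1 else 0) = w p + (if p = b then 1 else 0) := by
    intro p
    rw [mv_apply _ _ hab]
    grind
  have h2 := Finset.sum_congr (rfl : (Finset.univ : Finset (Fin n)) = Finset.univ)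
    (fun p _ => h p)
  simp only [Finset.sum_add_distrib, Finset.sum_ite_eq', Finset.mem_univ, if_true] at h2
  omega

/-- stage 2: from a `0/1` weight to a truncated weight. -/
theorem reach_stage2 {n : ℕ} (ε : Fin n → Bool) (k : ℕ) : ∀ (w : Fin n → ℕ),
    (∀ p, w p ≤ 1) → ∑ p, w p ≤ Mcount ε →
    (Finset.univ.filter (fun p => ε p = true ∧ w p ≠ 0)).card = k →
    ∃ w', ReachW w w' ∧ ∀ p, ε p = true → w' p = 0 := by
  induction k with
  | zero =>
    intro w _ _ hk
    refine ⟨w, Relation.ReflTransGen.refl, fun p hp => ?_⟩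
    rw [Finset.card_eq_zero, Finset.filter_eq_empty_iff] at hk
    have := hk (Finset.mem_univ p)
    simp only [hp, true_and, not_not] at this
    exact this
  | succ k ih =>
    intro w h1 hs hk
    obtain ⟨p, hp⟩ : (Finset.univ.filter (fun p => ε p = true ∧ w p ≠ 0)).Nonempty := by
      rw [← Finset.card_pos]; omega
    simp only [Finset.mem_filter, Finset.mem_univ, true_and] at hp
    obtain ⟨z, hz, hz0⟩ : ∃ z, ε z = false ∧ w z = 0 := by
      by_contra hcon
      push Not at hcon
      have h2 : Mcount ε + 1 ≤ ∑ p, w p := by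
        have h3 : (insert p (Finset.univ.filter fun p => ε p = false)).card = Mcount ε + 1 := by
          rw [Finset.card_insert_of_notMem]
          · rfl
          · simp [hp.1]
        rw [← h3, Finset.card_eq_sum_ones]
        refine le_trans (Finset.sum_le_sum (g := w) ?_)
          (Finset.sum_le_sum_of_subset (Finset.subset_univ _))
        intro i hi
        simp only [Finset.mem_insert, Finset.mem_filter, Finset.mem_univ, true_and] at hi
        rcases hi with rfl | hi
        · exact Nat.one_le_iff_ne_zero.2 hp.2
        · exact Nat.one_le_iff_ne_zero.2 (hcon i hi)
      omega
    have hpz : p ≠ z := by rintro rfl; simp [hz] at hp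
    have hp1 : 1 ≤ w p := Nat.one_le_iff_ne_zero.2 hp.2
    have r1 := jumpW' p z w hp1 hz0 (fun y _ => h1 y)
    obtain ⟨w', r2, hw'⟩ := ih (mv p z w) (by
        intro u
        rw [mv_apply _ _ hpz]
        have := h1 u
        grind) (by rw [sum_mv _ _ hpz _ hp1]; exact hs) (by
        have e : (Finset.univ.filter (fun y => ε y = true ∧ mv p z w y ≠ 0)) =
            (Finset.univ.filter (fun p => ε p = true ∧ w p ≠ 0)).erase p := by
          ext u
          simp only [Finset.mem_filter, Finset.mem_univ, true_and, Finset.mem_erase,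
            mv_apply _ _ hpz]
          have := h1 u
          grind
        rw [e, Finset.card_erase_of_mem (by simpa using hp), hk]
        rfl)
    exact ⟨w', Relation.ReflTransGen.trans r1 r2, hw'⟩

theorem Mcount_le {n : ℕ} (ε : Fin n → Bool) : Mcount ε ≤ n := by
  unfold Mcount
  exact le_trans (Finset.card_le_univ _) (by simp)

theorem reach_stage1 {n : ℕ} (ε : Fin n → Bool) (k : ℕ) : ∀ (w : Fin n → ℕ),
    ∑ p, w p ≤ Mcount ε →
    (Finset.univ.filter (fun p => w p = 0)).card = k →
    ∃ w', ReachW w w' ∧ ∀ p, ε p = true → w' p = 0 := by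
  induction k with
  | zero =>
    intro w hs hk
    refine reach_stage2 ε _ w ?_ hs rfl
    intro p
    by_contra hcon
    rw [Finset.card_eq_zero, Finset.filter_eq_empty_iff] at hk
    have h2 : ∑ p : Fin n, 1 < ∑ p, w p :=
      Finset.sum_lt_sum (fun i hi => Nat.one_le_iff_ne_zero.2 (hk hi))
        ⟨p, Finset.mem_univ p, by omega⟩
    have := Mcount_le ε
    simp at h2
    omega
  | succ k ih =>
    intro w hs hk
    by_cases hbig : ∀ p, w p ≤ 1
    · exact reach_stage2 ε _ w hbig hs rfl
    · push Not at hbig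
      obtain ⟨p0, hp0⟩ := hbig
      obtain ⟨z0, hz0⟩ : (Finset.univ.filter (fun p => w p = 0)).Nonempty := by
        rw [← Finset.card_pos]; omega
      simp only [Finset.mem_filter, Finset.mem_univ, true_and] at hz0
      let S : Finset (Fin n × Fin n) := Finset.univ.filter (fun u => 1 < w u.1 ∧ w u.2 = 0)
      obtain ⟨⟨p, z⟩, hpz, hmin⟩ := Finset.exists_min_image S
        (fun u => (u.1.val - u.2.val) + (u.2.val - u.1.val)) ⟨(p0, z0), by simp [S, hp0, hz0]⟩
      simp only [S, Finset.mem_filter, Finset.mem_univ, true_and, Prod.forall] at hpz hmin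
      obtain ⟨hp, hz⟩ := hpz
      have hne : p ≠ z := by rintro rfl; omega
      have r1 := jumpW' p z w (by omega) hz (by
        intro y hy
        by_contra hcon
        have h3 := hmin y z ⟨by omega, hz⟩
        have h1 : ∀ a b : Fin n, a < b ↔ a.val < b.val := fun a b => Iff.rfl
        simp only [h1] at hy
        omega)
      obtain ⟨w', r2, hw'⟩ := ih (mv p z w) (by rw [sum_mv _ _ hne _ (by omega)]; exact hs) (by
        have e : (Finset.univ.filter (fun y => mv p z w y = 0)) =
            (Finset.univ.filter (fun p => w p = 0)).erase z := by
          ext u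
          simp only [Finset.mem_filter, Finset.mem_univ, true_and, Finset.mem_erase,
            mv_apply _ _ hne]
          grind
        rw [e, Finset.card_erase_of_mem (by simpa using hz), hk]
        rfl)
      exact ⟨w', Relation.ReflTransGen.trans r1 r2, hw'⟩

/-! ### Generic box-moving operators -/

def cT {n : ℕ} (ε : Fin n → Bool) (X : K) (a b : Fin n) (m : Fin n → ℕ) : K :=
  if 1 ≤ m a ∧ (ε a = true → m a = 1) then
    X * qq ^ ((m b : ℤ) - (m a : ℤ) + 1) * brk (m b + 1) else 0

def kT {n : ℕ} (ε : Fin n → Bool) (a b : Fin n) (m : Fin n → ℕ) : K :=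
  qv ε a ^ (-(m a : ℤ)) * qv ε b ^ ((m b : ℤ))

def Tf {n r : ℕ} (ε : Fin n → Bool) (R : Fin r → Fin r → Prop) [DecidableRel R]
    (X : Fin r → K) (a b : Fin n) (g : VrW n r) : VrW n r := fun μ =>
  ∑ t : Fin r, (∏ s ∈ Finset.univ.filter (fun s => R s t), kT ε a b (μ s)) *
    cT ε (X t) a b (μ t) * g (Function.update μ t (mv a b (μ t)))

theorem qq_ne : qq ≠ 0 := RatFunc.X_ne_zero

theorem qq_pow_ne_one (k : ℕ) (hk : k ≠ 0) : qq ^ k ≠ 1 := by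
  intro h
  have h2 : (algebraMap (Polynomial ℚ) (RatFunc ℚ)) (Polynomial.X ^ k) =
      algebraMap (Polynomial ℚ) (RatFunc ℚ) 1 := by
    rw [map_pow, RatFunc.algebraMap_X, map_one]
    exact h
  have h3 := RatFunc.algebraMap_injective ℚ h2
  have h4 := congrArg Polynomial.natDegree h3
  simp at h4
  exact hk h4

theorem qq_sub_ne : qq - qq⁻¹ ≠ 0 := by
  intro h
  have h1 : qq * qq = 1 := by
    have h2 : qq = qq⁻¹ := sub_eq_zero.1 h
    nth_rewrite 2 [h2]
    exact mul_inv_cancel₀ qq_ne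
  exact qq_pow_ne_one 2 (by norm_num) (by rw [pow_two]; exact h1)

theorem brk_one : brk 1 = 1 := by
  unfold brk
  simp only [Nat.cast_one, zpow_one, zpow_neg]
  exact div_self qq_sub_ne

theorem qv_ne {n : ℕ} (ε : Fin n → Bool) (p : Fin n) : qv ε p ≠ 0 := by
  unfold qv
  split_ifs
  · exact neg_ne_zero.2 (inv_ne_zero qq_ne)
  · exact qq_ne

theorem qv_pow_ne_one {n : ℕ} (ε : Fin n → Bool) (p : Fin n) (k : ℕ) (hk : k ≠ 0) :
    (qv ε p) ^ (2 * k) ≠ 1 := by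
  unfold qv
  split_ifs
  · rw [pow_mul, neg_sq, inv_pow, inv_pow, ← pow_mul]
    intro h
    exact qq_pow_ne_one (2 * k) (by omega) (inv_eq_one.1 h)
  · exact qq_pow_ne_one (2 * k) (by omega)

theorem qv_zpow_sub_ne {n : ℕ} (ε : Fin n → Bool) (p : Fin n) (k : ℕ) (hk : k ≠ 0) :
    qv ε p ^ k - (qv ε p ^ k)⁻¹ ≠ 0 := by
  intro h
  have h2 := sub_eq_zero.1 h
  have h0 : qv ε p ^ k ≠ 0 := pow_ne_zero _ (qv_ne ε p)
  apply qv_pow_ne_one ε p k hk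
  rw [mul_comm, pow_mul, pow_two]
  nth_rewrite 2 [h2]
  exact mul_inv_cancel₀ h0

/-- for admissible `b`, `[b]` may be computed with `q_p` in place of `q`. -/
theorem brk_qv {n : ℕ} (ε : Fin n → Bool) (p : Fin n) (b : ℕ) (hb : ε p = true → b ≤ 1) :
    brk b = (qv ε p ^ b - (qv ε p ^ b)⁻¹) / (qv ε p - (qv ε p)⁻¹) := by
  by_cases he : ε p = true
  · have hb' := hb he
    have hne := qv_zpow_sub_ne ε p 1 one_ne_zero
    rw [pow_one] at hne
    interval_cases b
    · simp [brk]
    · rw [brk_one, pow_one, div_self hne]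
  · simp [brk, qv, he]

theorem Tf_ne {n r : ℕ} {ε : Fin n → Bool} {R : Fin r → Fin r → Prop} [DecidableRel R]
    {X : Fin r → K} {a b : Fin n} {g : VrW n r} {μ : Fin r → Fin n → ℕ}
    (h : Tf ε R X a b g μ ≠ 0) :
    ∃ t, 1 ≤ μ t a ∧ (ε a = true → μ t a = 1) ∧
      g (Function.update μ t (mv a b (μ t))) ≠ 0 := by
  obtain ⟨t, _, ht⟩ := Finset.exists_ne_zero_of_sum_ne_zero h
  have h1 := left_ne_zero_of_mul ht
  have h2 := right_ne_zero_of_mul h1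
  unfold cT at h2
  split_ifs at h2 with h3
  · exact ⟨t, h3.1, h3.2, right_ne_zero_of_mul ht⟩
  · exact absurd rfl h2

/-- fusion of two moves through an empty letter `o`. -/
theorem Tf_fusion {n r : ℕ} (ε : Fin n → Bool) (R : Fin r → Fin r → Prop) [DecidableRel R]
    (hR : ∀ s, ¬ R s s) (X Y : Fin r → K) (a o b : Fin n) (hao : a ≠ o) (hob : o ≠ b)
    (hab : a ≠ b) (g : VrW n r) (hg : ∀ μ, g μ ≠ 0 → ∀ t, μ t o = 0) :
    Tf ε R X a o (Tf ε R Y o b g) = Tf ε R (fun t => X t * Y t) a b g := by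
  funext μ
  by_cases hμ : ∀ t, μ t o = 0
  · unfold Tf
    refine Finset.sum_congr rfl fun t _ => ?_
    set μ' := Function.update μ t (mv a o (μ t)) with hμ'
    have ht : μ' t = mv a o (μ t) := by simp [hμ']
    have hs : ∀ s, s ≠ t → μ' s = μ s := fun s hs => by simp [hμ', hs]
    rw [Finset.sum_eq_single t]
    · have e1 : Function.update μ' t (mv o b (μ' t)) = Function.update μ t (mv a b (μ t)) := by
        rw [ht, hμ', Function.update_idem]
        congr 1
        funext u
        simp only [mv_apply _ _ hao, mv_apply _ _ hob, mv_apply _ _ hab]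
        have := hμ t
        grind
      rw [e1]
      have e2 : (∏ s ∈ Finset.univ.filter (fun s => R s t), kT ε o b (μ' s)) =
          ∏ s ∈ Finset.univ.filter (fun s => R s t), kT ε o b (μ s) := by
        refine Finset.prod_congr rfl fun s hs' => ?_
        rw [hs s]
        rintro rfl
        simp only [Finset.mem_filter] at hs'
        exact hR _ hs'.2
      have e3 : (∏ s ∈ Finset.univ.filter (fun s => R s t), kT ε a o (μ s)) *
          (∏ s ∈ Finset.univ.filter (fun s => R s t), kT ε o b (μ s)) =
          ∏ s ∈ Finset.univ.filter (fun s => R s t), kT ε a b (μ s) := by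
        rw [← Finset.prod_mul_distrib]
        refine Finset.prod_congr rfl fun s _ => ?_
        simp [kT, hμ s]
      have e4 : cT ε (X t) a o (μ t) * cT ε (Y t) o b (μ' t) =
          cT ε (X t * Y t) a b (μ t) := by
        have v1 : mv a o (μ t) o = 1 := by simp [mv_apply _ _ hao, hμ t]
        have v2 : mv a o (μ t) b = μ t b := by simp [mv_apply _ _ hao, hob.symm, hab.symm]
        rw [ht]
        unfold cT
        rw [v1, v2, hμ t]
        by_cases hc : 1 ≤ μ t a ∧ (ε a = true → μ t a = 1)
        · rw [if_pos hc, if_pos hc, if_pos ⟨le_refl 1, fun _ => rfl⟩, zero_add, brk_one]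
          have : qq ^ ((μ t b : ℤ) - (μ t a : ℤ) + 1) =
              qq ^ (((0 : ℕ) : ℤ) - (μ t a : ℤ) + 1) *
                qq ^ ((μ t b : ℤ) - ((1 : ℕ) : ℤ) + 1) := by
            rw [← zpow_add₀ qq_ne]
            congr 1
            push_cast
            ring
          rw [this]
          ring
        · rw [if_neg hc, if_neg hc, zero_mul]
      rw [e2, ← e3, ← e4]
      ring
    · intro u _ hu
      have : cT ε (Y u) o b (μ' u) = 0 := by
        unfold cT
        rw [if_neg]
        rw [hs u hu, hμ u]
        simp
      rw [this]
      ring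
    · intro h
      exact absurd (Finset.mem_univ t) h
  · push Not at hμ
    obtain ⟨t0, ht0⟩ := hμ
    have h1 : Tf ε R (fun t => X t * Y t) a b g μ = 0 := by
      by_contra hne
      obtain ⟨t, _, _, h3⟩ := Tf_ne hne
      have h4 := hg _ h3 t0
      by_cases e : t0 = t
      · subst e
        simp only [Function.update_self, mv_apply _ _ hab, hob, hao.symm, if_false] at h4
        exact ht0 h4
      · rw [Function.update_of_ne e] at h4
        exact ht0 h4
    rw [h1]
    by_contra hne
    obtain ⟨t, _, _, h3⟩ := Tf_ne hne
    obtain ⟨u, h5, _, h6⟩ := Tf_ne h3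
    have h4 := hg _ h6
    have h7 := h4 t
    have h8 := h4 t0
    by_cases e : u = t
    · subst e
      simp only [Function.update_self, mv_apply _ _ hob, mv_apply _ _ hao] at h7
      by_cases e' : t0 = u
      · subst e'
        simp [hob] at h7
        exact ht0 h7
      · rw [Function.update_of_ne e', Function.update_of_ne e'] at h8
        exact ht0 h8
    · rw [Function.update_of_ne (Ne.symm e)] at h7
      simp [mv_apply _ _ hao] at h7

/-- admissible multi-indices -/
def Adm {n r : ℕ} (ε : Fin n → Bool) (l : Fin r → ℕ) (μ : Fin r → Fin n → ℕ) : Prop :=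
  ∀ t, μ t ∈ MsetP n ε (l t)

/-- functions in `RSpan` of weight `w` -/
def SuppW {n r : ℕ} (ε : Fin n → Bool) (l : Fin r → ℕ) (w : Fin n → ℕ) (g : VrW n r) : Prop :=
  ∀ μ, g μ ≠ 0 → Adm ε l μ ∧ ∀ p, ∑ t, μ t p = w p

theorem Tf_adm {n r : ℕ} (ε : Fin n → Bool) (R : Fin r → Fin r → Prop) [DecidableRel R]
    (X : Fin r → K) (a b : Fin n) (hab : a ≠ b) (l : Fin r → ℕ) (μ : Fin r → Fin n → ℕ) (t : Fin r)
    (h1 : 1 ≤ μ t a) (h2 : ε a = true → μ t a = 1)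
    (h3 : Adm ε l (Function.update μ t (mv a b (μ t)))) : Adm ε l μ := by
  intro s
  have h4 := h3 s
  by_cases e : s = t
  · subst e
    rw [Function.update_self] at h4
    obtain ⟨h5, h6⟩ := h4
    refine ⟨fun p hp => ?_, ?_⟩
    · have h7 := h5 p hp
      rw [mv_apply _ _ hab] at h7
      grind
    · rw [← h6, sum_mv _ _ hab _ h1]
  · rw [Function.update_of_ne e] at h4
    exact h4

theorem sum_update_mv {n r : ℕ} (a b : Fin n) (hab : a ≠ b) (μ : Fin r → Fin n → ℕ) (t : Fin r)
    (h1 : 1 ≤ μ t a) (p : Fin n) :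
    (∑ s, Function.update μ t (mv a b (μ t)) s p) + (if p = a then 1 else 0) =
      (∑ s, μ s p) + (if p = b then 1 else 0) := by
  rw [← Finset.add_sum_erase _ _ (Finset.mem_univ t), ← Finset.add_sum_erase _ _ (Finset.mem_univ t)]
  have : ∑ s ∈ Finset.univ.erase t, Function.update μ t (mv a b (μ t)) s p =
      ∑ s ∈ Finset.univ.erase t, μ s p := by
    refine Finset.sum_congr rfl fun s hs => ?_
    rw [Function.update_of_ne (Finset.ne_of_mem_erase hs)]
  rw [this, Function.update_self, mv_apply _ _ hab]
  grind

theorem Tf_supp {n r : ℕ} (ε : Fin n → Bool) (R : Fin r → Fin r → Prop) [DecidableRel R]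
    (X : Fin r → K) (a b : Fin n) (hab : a ≠ b) (l : Fin r → ℕ) (w : Fin n → ℕ) (g : VrW n r)
    (hg : SuppW ε l w g) : SuppW ε l (mv b a w) (Tf ε R X a b g) := by
  intro μ hμ
  obtain ⟨t, h1, h2, h3⟩ := Tf_ne hμ
  obtain ⟨h4, h5⟩ := hg _ h3
  refine ⟨Tf_adm ε R X a b hab l μ t h1 h2 h4, fun p => ?_⟩
  have h6 := sum_update_mv a b hab μ t h1 p
  rw [h5] at h6
  rw [mv_apply _ _ hab.symm]
  grind

/-- the reversibility of an elementary move into an empty letter -/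
theorem Tf_back {n r : ℕ} (ε : Fin n → Bool) (R : Fin r → Fin r → Prop) [DecidableRel R]
    (R' : Fin r → Fin r → Prop) [DecidableRel R']
    (hR' : ∀ s, ¬ R' s s)
    (a b : Fin n) (hab : a ≠ b) (l : Fin r → ℕ) (w : Fin n → ℕ) (g : VrW n r)
    (hb : w b = 0) (hg : SuppW ε l w g) (c : K)
    (hc : ∀ ν : Fin r → Fin n → ℕ, Adm ε l ν → (∀ p, ∑ t, ν t p = w p) →
      ∑ t, (∏ s ∈ Finset.univ.filter (fun s => R s t), (qv ε a ^ (ν s a))⁻¹) * brk (ν t a) *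
        (∏ s ∈ Finset.univ.filter (fun s => R' s t), qv ε a ^ (ν s a)) = c) :
    Tf ε R (fun _ => 1) a b (Tf ε R' (fun _ => 1) b a g) = c • g := by
  funext ν
  by_cases hν : Adm ε l ν ∧ ∀ p, ∑ t, ν t p = w p
  · rw [Pi.smul_apply, smul_eq_mul, ← hc ν hν.1 hν.2, Finset.sum_mul]
    have hb0 : ∀ t, ν t b = 0 := by
      intro t
      have h1 := hν.2 b
      rw [hb, Finset.sum_eq_zero_iff] at h1
      exact h1 t (Finset.mem_univ t)
    unfold Tf
    refine Finset.sum_congr rfl fun t _ => ?_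
    set μ' := Function.update ν t (mv a b (ν t)) with hμ'
    have ht : μ' t = mv a b (ν t) := by simp [hμ']
    have hs : ∀ s, s ≠ t → μ' s = ν s := fun s hs => by simp [hμ', hs]
    have k1 : (∏ s ∈ Finset.univ.filter (fun s => R s t), kT ε a b (ν s)) =
        ∏ s ∈ Finset.univ.filter (fun s => R s t), (qv ε a ^ (ν s a))⁻¹ := by
      refine Finset.prod_congr rfl fun s _ => ?_
      simp [kT, hb0 s]
    have hodd : ε a = true → ν t a ≤ 1 := (hν.1 t).1 a
    by_cases h1 : 1 ≤ ν t a
    · have hcond : 1 ≤ ν t a ∧ (ε a = true → ν t a = 1) :=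
        ⟨h1, fun h => le_antisymm (hodd h) h1⟩
      rw [Finset.sum_eq_single t]
      · have e1 : Function.update μ' t (mv b a (μ' t)) = ν := by
          rw [ht, hμ', Function.update_idem]
          convert Function.update_eq_self t ν
          funext u
          simp only [mv_apply _ _ hab, mv_apply _ _ hab.symm]
          have := hb0 t
          grind
        rw [e1, k1]
        have k2 : (∏ s ∈ Finset.univ.filter (fun s => R' s t), kT ε b a (μ' s)) =
            ∏ s ∈ Finset.univ.filter (fun s => R' s t), (qv ε a ^ (ν s a)) := by
          refine Finset.prod_congr rfl fun s hs' => ?_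
          rw [hs s]
          · simp [kT, hb0 s]
          · rintro rfl
            simp only [Finset.mem_filter] at hs'
            exact hR' _ hs'.2
        have e4 : cT ε 1 a b (ν t) * cT ε 1 b a (μ' t) = brk (ν t a) := by
          have v1 : mv a b (ν t) b = 1 := by simp [mv_apply _ _ hab, hb0 t]
          have v2 : mv a b (ν t) a = ν t a - 1 := by simp [mv_apply _ _ hab, hab]
          rw [ht]
          unfold cT
          rw [v1, v2, hb0 t, if_pos hcond, if_pos ⟨le_refl 1, fun _ => rfl⟩]
          rw [Nat.sub_add_cancel h1, zero_add, brk_one]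
          have : qq ^ (((0 : ℕ) : ℤ) - (ν t a : ℤ) + 1) *
              qq ^ (((ν t a - 1 : ℕ) : ℤ) - ((1 : ℕ) : ℤ) + 1) = 1 := by
            rw [← zpow_add₀ qq_ne]
            convert zpow_zero qq
            push_cast [h1]
            ring
          linear_combination (brk (ν t a)) * this
        rw [k2, ← e4]
        ring
      · intro u _ hu
        have : cT ε (1 : K) b a (μ' u) = 0 := by
          unfold cT
          rw [if_neg]
          rw [hs u hu, hb0 u]
          simp
        rw [this]
        ring
      · intro h
        exact absurd (Finset.mem_univ t) h
    · have h2 : ν t a = 0 := by omega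
      have h3 : cT ε (1 : K) a b (ν t) = 0 := by
        unfold cT
        rw [if_neg]
        exact fun h => h1 h.1
      have h4 : brk (ν t a) = 0 := by rw [h2]; simp [brk]
      rw [h3, h4]
      ring
  · have h1 : g ν = 0 := by
      by_contra h
      exact hν (hg ν h)
    rw [Pi.smul_apply, h1, smul_zero]
    by_contra h
    apply hν
    have h2 := Tf_supp ε R (fun _ => 1) a b hab l _ _ (Tf_supp ε R' (fun _ => 1) b a hab.symm l w g hg)
    have h3 := (h2 ν h).1
    refine ⟨h3, ?_⟩
    obtain ⟨t, h5, -, h6⟩ := Tf_ne h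
    obtain ⟨u, h7, -, h8⟩ := Tf_ne h6
    intro p
    have h9 := sum_update_mv a b hab ν t h5 p
    have h10 := sum_update_mv b a hab.symm _ u h7 p
    have h11 := (hg _ h8).2 p
    omega

theorem telescope_lt {n r : ℕ} (ε : Fin n → Bool) (a : Fin n) (β : Fin r → ℕ)
    (hβ : ε a = true → ∀ t, β t ≤ 1) :
    ∑ t, (∏ s ∈ Finset.univ.filter (fun s => s < t), (qv ε a ^ (β s))⁻¹) * brk (β t) *
        (∏ s ∈ Finset.univ.filter (fun s => t < s), qv ε a ^ (β s)) =
      (qv ε a ^ (∑ t, β t) - (qv ε a ^ (∑ t, β t))⁻¹) / (qv ε a - (qv ε a)⁻¹) := by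
  have h := Finset.prod_add_ordered (Finset.univ : Finset (Fin r)) (fun s => qv ε a ^ (β s))
    (fun s => (qv ε a ^ (β s))⁻¹ - qv ε a ^ (β s))
  simp only [add_sub_cancel] at h
  rw [Finset.prod_inv_distrib, Finset.prod_pow_eq_pow_sum] at h
  rw [h, sub_add_cancel_left, ← Finset.sum_neg_distrib, Finset.sum_div]
  refine Finset.sum_congr rfl fun t _ => ?_
  rw [brk_qv ε a (β t) (fun h => hβ h t)]
  ring

theorem telescope_gt {n r : ℕ} (ε : Fin n → Bool) (a : Fin n) (β : Fin r → ℕ)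
    (hβ : ε a = true → ∀ t, β t ≤ 1) :
    ∑ t, (∏ s ∈ Finset.univ.filter (fun s => t < s), (qv ε a ^ (β s))⁻¹) * brk (β t) *
        (∏ s ∈ Finset.univ.filter (fun s => s < t), qv ε a ^ (β s)) =
      (qv ε a ^ (∑ t, β t) - (qv ε a ^ (∑ t, β t))⁻¹) / (qv ε a - (qv ε a)⁻¹) := by
  have h := Finset.prod_add_ordered (Finset.univ : Finset (Fin r)) (fun s => (qv ε a ^ (β s))⁻¹)
    (fun s => qv ε a ^ (β s) - (qv ε a ^ (β s))⁻¹)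
  simp only [add_sub_cancel] at h
  have h0 : ∏ i, (qv ε a ^ β i)⁻¹ = (qv ε a ^ (∑ t, β t))⁻¹ := by
    rw [Finset.prod_inv_distrib, Finset.prod_pow_eq_pow_sum]
  rw [h0, Finset.prod_pow_eq_pow_sum] at h
  rw [← sub_eq_iff_eq_add'] at h
  rw [h, Finset.sum_div]
  refine Finset.sum_congr rfl fun t _ => ?_
  rw [brk_qv ε a (β t) (fun h => hβ h t)]
  ring

/-! ### Relation with the generators -/

theorem fin_sub_one_ne {n : ℕ} [NeZero n] (hn : 2 ≤ n) (i : Fin n) : i - 1 ≠ i := by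
  intro h
  have h1 : (1 : Fin n) = 0 := by
    have := sub_eq_self.1 h
    exact this
  have h2 := congrArg Fin.val h1
  rw [Fin.val_one', Fin.val_zero, Nat.mod_eq_of_lt (by omega)] at h2
  omega

theorem eWr_eq {n r : ℕ} [NeZero n] (ε : Fin n → Bool) (x : Fin r → K) (i : Fin n)
    (g : VrW n r) :
    eWr n r ε x i g = Tf ε (fun s t => s < t) (fun t => if i = 0 then x t else 1) (i - 1) i g := by
  funext μ
  simp only [eWr, LinearMap.sum_apply, Finset.sum_apply, Tf, shift2, LinearMap.coe_mk,
    AddHom.coe_mk, Pi.zero_apply, zero_mul, zero_add]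
  rfl

theorem fWr_eq {n r : ℕ} [NeZero n] (hn : 2 ≤ n) (ε : Fin n → Bool) (x : Fin r → K) (i : Fin n)
    (g : VrW n r) :
    fWr n r ε x i g =
      Tf ε (fun s t => t < s) (fun t => if i = 0 then (x t)⁻¹ else 1) i (i - 1) g := by
  have hne := fin_sub_one_ne hn i
  funext μ
  simp only [fWr, LinearMap.sum_apply, Finset.sum_apply, Tf, shift2, LinearMap.coe_mk,
    AddHom.coe_mk, Pi.zero_apply, zero_mul, zero_add]
  refine Finset.sum_congr rfl fun t _ => ?_
  have e1 : σF i (μ t) = mv i (i - 1) (μ t) := by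
    unfold σF mv
    rw [Function.update_comm hne]
  have e2 : (∏ s ∈ Finset.univ.filter (fun s => t < s), kW ε i (μ s)) =
      ∏ s ∈ Finset.univ.filter (fun s => t < s), kT ε i (i - 1) (μ s) := by
    refine Finset.prod_congr rfl fun s _ => ?_
    unfold kW kT
    rw [mul_comm]
  rw [e1, e2]
  have e3 : cF ε (x t) i (μ t) = cT ε (if i = 0 then (x t)⁻¹ else 1) i (i - 1) (μ t) := rfl
  rw [e3]
  ring

theorem Adm_finite {n r : ℕ} (ε : Fin n → Bool) (l : Fin r → ℕ) :
    {μ : Fin r → Fin n → ℕ | Adm ε l μ}.Finite := by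
  apply Set.Finite.subset (Set.finite_Iic (fun (t : Fin r) (_ : Fin n) => l t))
  intro μ hμ t p
  have h := (hμ t).2
  show μ t p ≤ l t
  rw [← h]
  exact Finset.single_le_sum (f := μ t) (fun _ _ => Nat.zero_le _) (Finset.mem_univ p)

theorem mem_RSpan {n r : ℕ} (ε : Fin n → Bool) (l : Fin r → ℕ) (g : VrW n r) :
    g ∈ RSpan n r ε l ↔ ∀ μ, g μ ≠ 0 → Adm ε l μ := by
  constructor
  · intro hg
    unfold RSpan at hg
    induction hg using Submodule.span_induction with
    | mem g h =>
      obtain ⟨μ, hμ, rfl⟩ := h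
      intro ν hν
      by_cases e : ν = μ
      · rw [e]; exact hμ
      · rw [Pi.single_eq_of_ne e] at hν
        exact absurd rfl hν
    | zero => intro μ h; exact absurd rfl h
    | add a b _ _ ha hb =>
      intro μ h
      by_cases e : a μ = 0
      · apply hb
        intro e2
        apply h
        rw [Pi.add_apply, e, e2, add_zero]
      · exact ha μ e
    | smul c a _ ha =>
      intro μ h
      apply ha
      intro e
      apply h
      rw [Pi.smul_apply, e, smul_zero]
  · intro h
    have e : g = ∑ μ ∈ (Adm_finite ε l).toFinset, g μ • (Pi.single μ 1 : VrW n r) := by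
      funext ν
      rw [Finset.sum_apply]
      by_cases hν : Adm ε l ν
      · rw [Finset.sum_eq_single ν]
        · simp
        · intro b _ hb
          rw [Pi.smul_apply, Pi.single_eq_of_ne hb.symm, smul_zero]
        · intro h'
          exact absurd ((Adm_finite ε l).mem_toFinset.2 hν) h'
      · rw [Finset.sum_eq_zero]
        · by_contra h'
          exact hν (h ν h')
        · intro b hb
          have hb' : Adm ε l b := (Adm_finite ε l).mem_toFinset.1 hb
          have : ν ≠ b := by rintro rfl; exact hν hb'
          rw [Pi.smul_apply, Pi.single_eq_of_ne this, smul_zero]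
    rw [e]
    refine Submodule.sum_mem _ fun μ hμ => Submodule.smul_mem _ _ (Submodule.subset_span ?_)
    exact ⟨μ, (Adm_finite ε l).mem_toFinset.1 hμ, rfl⟩

/-! ### Weight projections -/

open Classical in
/-- restriction of a function to a set of indices -/
def restr {ι : Type} (S : Set ι) (g : ι → K) : ι → K := fun μ => if μ ∈ S then g μ else 0

/-- a submodule stable under a diagonal operator contains the eigencomponents of its elements
of finite support. -/
theorem diag_proj {ι : Type} (N : Submodule K (ι → K)) (c : ι → K)
    (hN : ∀ v ∈ N, (fun μ => c μ * v μ) ∈ N) (A : Set ι) (hA : A.Finite)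
    (v : ι → K) (hv : v ∈ N) (hvA : ∀ μ, v μ ≠ 0 → μ ∈ A) (c0 : K) :
    restr {μ | c μ = c0} v ∈ N := by
  classical
  have key : ∀ T : Finset K, c0 ∉ T →
      (fun μ => (∏ d ∈ T, (c μ - d) / (c0 - d)) * v μ) ∈ N := by
    intro T
    induction T using Finset.induction_on with
    | empty => intro _; simpa using hv
    | insert d T hd ih =>
      intro hT
      have h1 := ih (fun h => hT (Finset.mem_insert_of_mem h))
      have h2 := N.smul_mem (c0 - d)⁻¹ (N.sub_mem (hN _ h1) (N.smul_mem d h1))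
      convert h2 using 1
      funext μ
      simp only [Pi.smul_apply, Pi.sub_apply, smul_eq_mul]
      rw [Finset.prod_insert hd]
      ring
  let T : Finset K := (hA.toFinset.image c).erase c0
  have h := key T (Finset.notMem_erase _ _)
  convert h using 1
  funext μ
  unfold restr
  by_cases h1 : v μ = 0
  · rw [h1]; simp
  · by_cases h2 : c μ = c0
    · rw [if_pos (show μ ∈ {μ | c μ = c0} from h2), Finset.prod_eq_one, one_mul]
      intro d hd
      rw [h2, div_self]
      intro h3
      rw [sub_eq_zero] at h3
      exact (Finset.ne_of_mem_erase hd) h3.symm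
    · rw [if_neg (show ¬ μ ∈ {μ | c μ = c0} from h2), Finset.prod_eq_zero (i := c μ), zero_mul]
      · refine Finset.mem_erase.2 ⟨h2, Finset.mem_image.2 ⟨μ, ?_, rfl⟩⟩
        exact hA.mem_toFinset.2 (hvA μ h1)
      · rw [sub_self, zero_div]

theorem qh_eig {n r : ℕ} (ε : Fin n → Bool) (p : Fin n) (μ : Fin r → Fin n → ℕ) :
    ∏ t : Fin r, qhW ε (fun u => if u = p then 2 else 0) (μ t) = qq ^ (2 * ∑ t, μ t p) := by
  rw [Finset.mul_sum, ← Finset.prod_pow_eq_pow_sum]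
  refine Finset.prod_congr rfl fun t _ => ?_
  unfold qhW
  rw [Finset.prod_eq_single p]
  · simp only [if_true]
    unfold sgn qv
    split_ifs with h
    · have e : (-1 : ℤ) * 2 * (μ t p : ℤ) = -((2 * μ t p : ℕ) : ℤ) := by push_cast; ring
      rw [e, zpow_neg, zpow_natCast, pow_mul, neg_sq, inv_pow, inv_pow, inv_inv, ← pow_mul]
    · have e : (1 : ℤ) * 2 * (μ t p : ℤ) = ((2 * μ t p : ℕ) : ℤ) := by push_cast; ring
      rw [e, zpow_natCast]
  · intro b _ hb
    simp [hb]
  · intro h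
    exact absurd (Finset.mem_univ p) h

theorem qq_pow_inj {a b : ℕ} (h : qq ^ a = qq ^ b) : a = b := by
  wlog hab : a ≤ b generalizing a b with H
  · exact (H h.symm (by omega)).symm
  by_contra hne
  obtain ⟨c, rfl⟩ := Nat.exists_eq_add_of_le hab
  rw [pow_add] at h
  have h1 : qq ^ a * 1 = qq ^ a * qq ^ c := by rw [mul_one]; exact h
  have h2 := mul_left_cancel₀ (pow_ne_zero a qq_ne) h1
  exact qq_pow_ne_one c (by omega) h2.symm

theorem weight_proj {n r : ℕ} (ε : Fin n → Bool) (l : Fin r → ℕ) (N : Submodule K (VrW n r))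
    (hNR : N ≤ RSpan n r ε l) (hq : ∀ h : Fin n → ℤ, ∀ v ∈ N, qhWr n r ε h v ∈ N)
    (w : Fin n → ℕ) (v : VrW n r) (hv : v ∈ N) :
    restr {μ | ∀ p, ∑ t, μ t p = w p} v ∈ N := by
  classical
  have key : ∀ S : Finset (Fin n), restr {μ | ∀ p ∈ S, ∑ t, μ t p = w p} v ∈ N := by
    intro S
    induction S using Finset.induction_on with
    | empty =>
      convert hv using 1
      funext μ
      simp [restr]
    | insert p S hp ih =>
      have h1 := diag_proj N (fun μ => ∏ t : Fin r, qhW ε (fun u => if u = p then 2 else 0) (μ t))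
        (fun v hv => by
          convert hq (fun u => if u = p then 2 else 0) v hv using 1
          funext μ
          simp [qhWr, shift2])
        _ (Adm_finite ε l) _ ih (fun μ hμ => (mem_RSpan ε l _).1 (hNR ih) μ hμ) (qq ^ (2 * w p))
      convert h1 using 1
      funext μ
      have h2 : (∏ t : Fin r, qhW ε (fun u => if u = p then 2 else 0) (μ t) = qq ^ (2 * w p)) ↔
          ∑ t, μ t p = w p := by
        rw [qh_eig]
        constructor
        · intro h
          have := qq_pow_inj h
          omega
        · intro h
          rw [h]
      simp only [restr, Set.mem_ofPred_eq, h2, Finset.forall_mem_insert]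
      by_cases h3 : ∑ t, μ t p = w p
      · simp [h3]
      · simp [h3]
  have := key Finset.univ
  simpa using this

/-! ### Moves in a submodule -/

theorem adjF_index {n : ℕ} [NeZero n] {a b : Fin n} (h : a.val + 1 = b.val) : b ≠ 0 ∧ b - 1 = a := by
  have hb : b ≠ 0 := by
    rintro rfl
    rw [Fin.val_zero] at h
    omega
  refine ⟨hb, ?_⟩
  rw [sub_eq_iff_eq_add]
  apply Fin.ext
  have := b.isLt
  rw [Fin.val_add, Fin.val_one', Nat.add_mod_mod, Nat.mod_eq_of_lt (by omega)]
  exact h.symm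

theorem move_back {n r : ℕ} [NeZero n] (hn : 2 ≤ n) (ε : Fin n → Bool) (x : Fin r → K)
    (l : Fin r → ℕ) (w w' : Fin n → ℕ) (hstep : StepW w w') :
    ∃ (F G : VrW n r → VrW n r) (c : K), c ≠ 0 ∧
      (∀ N : Submodule K (VrW n r),
        (∀ i : Fin n, ∀ v ∈ N, eWr n r ε x i v ∈ N ∧ fWr n r ε x i v ∈ N) →
        ∀ v ∈ N, F v ∈ N ∧ G v ∈ N) ∧
      (∀ g, SuppW ε l w g → SuppW ε l w' (F g) ∧ G (F g) = c • g) ∧ G 0 = 0 := by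
  obtain ⟨a, b, hadj, ha, hb, rfl⟩ := hstep
  have hab := hadj.ne
  have hc : (qv ε a ^ (w a) - (qv ε a ^ (w a))⁻¹) / (qv ε a - (qv ε a)⁻¹) ≠ 0 := by
    apply div_ne_zero (qv_zpow_sub_ne ε a (w a) (by omega))
    have := qv_zpow_sub_ne ε a 1 one_ne_zero
    rwa [pow_one] at this
  have hz : ∀ (R : Fin r → Fin r → Prop) [DecidableRel R], Tf ε R (fun _ => 1) a b 0 = 0 := by
    intro R _
    funext μ
    simp [Tf]
  rcases hadj with h | h
  · obtain ⟨h0, h1⟩ := adjF_index h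
    refine ⟨Tf ε (fun s t => t < s) (fun _ => 1) b a, Tf ε (fun s t => s < t) (fun _ => 1) a b,
      _, hc, ?_, ?_, hz _⟩
    · intro N hN v hv
      have h2 := hN b v hv
      rw [eWr_eq, fWr_eq hn, h1] at h2
      simp only [h0, if_false] at h2
      exact ⟨h2.2, h2.1⟩
    · intro g hg
      refine ⟨Tf_supp _ _ _ _ _ hab.symm _ _ _ hg, ?_⟩
      apply Tf_back ε (fun s t => s < t) (fun s t => t < s) (fun s => lt_irrefl s) a b hab l w g hb hg
      intro ν hν hw
      rw [telescope_lt ε a (fun t => ν t a) (fun he t => (hν t).1 a he), hw a]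
  · obtain ⟨h0, h1⟩ := adjF_index h
    refine ⟨Tf ε (fun s t => s < t) (fun _ => 1) b a, Tf ε (fun s t => t < s) (fun _ => 1) a b,
      _, hc, ?_, ?_, hz _⟩
    · intro N hN v hv
      have h2 := hN a v hv
      rw [eWr_eq, fWr_eq hn, h1] at h2
      simp only [h0, if_false] at h2
      exact ⟨h2.1, h2.2⟩
    · intro g hg
      refine ⟨Tf_supp _ _ _ _ _ hab.symm _ _ _ hg, ?_⟩
      apply Tf_back ε (fun s t => t < s) (fun s t => s < t) (fun s => lt_irrefl s) a b hab l w g hb hg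
      intro ν hν hw
      rw [telescope_gt ε a (fun t => ν t a) (fun he t => (hν t).1 a he), hw a]

theorem reach_exists {n r : ℕ} [NeZero n] (hn : 2 ≤ n) (ε : Fin n → Bool) (x : Fin r → K)
    (l : Fin r → ℕ) (N : Submodule K (VrW n r))
    (hN : ∀ i : Fin n, ∀ v ∈ N, eWr n r ε x i v ∈ N ∧ fWr n r ε x i v ∈ N)
    (w w' : Fin n → ℕ) (h : ReachW w w') (hex : ∃ g ∈ N, g ≠ 0 ∧ SuppW ε l w g) :
    ∃ g ∈ N, g ≠ 0 ∧ SuppW ε l w' g := by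
  induction h with
  | refl => exact hex
  | tail _ hs ih =>
    obtain ⟨g, hgN, hg0, hgs⟩ := ih
    obtain ⟨F, G, c, hc, hFG, hs, hG0⟩ := move_back hn ε x l _ _ hs
    refine ⟨F g, (hFG N hN g hgN).1, ?_, (hs g hgs).1⟩
    intro h0
    have h1 := (hs g hgs).2
    rw [h0, hG0] at h1
    rcases smul_eq_zero.1 h1.symm with h2 | h2
    · exact hc h2
    · exact hg0 h2

theorem reach_all {n r : ℕ} [NeZero n] (hn : 2 ≤ n) (ε : Fin n → Bool) (x : Fin r → K)
    (l : Fin r → ℕ) (N : Submodule K (VrW n r))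
    (hN : ∀ i : Fin n, ∀ v ∈ N, eWr n r ε x i v ∈ N ∧ fWr n r ε x i v ∈ N)
    (w w' : Fin n → ℕ) (h : ReachW w w') (hall : ∀ g, SuppW ε l w' g → g ∈ N) :
    ∀ g, SuppW ε l w g → g ∈ N := by
  induction h using Relation.ReflTransGen.head_induction_on with
  | refl => exact hall
  | head hs _ ih =>
    intro g hg
    obtain ⟨F, G, c, hc, hFG, hs, hG0⟩ := move_back hn ε x l _ _ hs
    have h1 := (hFG N hN _ (ih _ (hs g hg).1)).2
    rw [(hs g hg).2] at h1
    have h2 := N.smul_mem c⁻¹ h1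
    rwa [smul_smul, inv_mul_cancel₀ hc, one_smul] at h2

/-! ### Paths between consecutive even letters -/

theorem ofNat_ne {n : ℕ} [NeZero n] {j k : ℕ} (h1 : j < k) (h2 : k < j + n) :
    Fin.ofNat n j ≠ Fin.ofNat n k := by
  intro h
  have h3 := congrArg Fin.val h
  simp only [Fin.val_ofNat] at h3
  have h4 : n ∣ k - j := (Nat.modEq_iff_dvd' h1.le).1 h3
  have := Nat.le_of_dvd (by omega) h4
  omega

theorem ofNat_sub_one {n : ℕ} [NeZero n] (k : ℕ) :
    Fin.ofNat n (k + 1) - 1 = Fin.ofNat n k := by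
  rw [sub_eq_iff_eq_add]
  apply Fin.ext
  rw [Fin.val_add, Fin.val_one']
  simp [Fin.val_ofNat]

theorem ofNat_eq_zero {n : ℕ} [NeZero n] (k : ℕ) : Fin.ofNat n k = 0 ↔ n ∣ k := by
  rw [Fin.ext_iff, Fin.val_ofNat, Fin.val_zero, Nat.dvd_iff_mod_eq_zero]

open Classical in
theorem pathE {n r : ℕ} [NeZero n] (ε : Fin n → Bool) (x : Fin r → K)
    (N : Submodule K (VrW n r)) (hN : ∀ i : Fin n, ∀ v ∈ N, eWr n r ε x i v ∈ N)
    (v : VrW n r) (hv : v ∈ N) (d : ℕ) : ∀ k : ℕ, d + 1 < n →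
    (∀ j, k < j → j < k + d + 1 → ∀ μ, v μ ≠ 0 → ∀ t, μ t (Fin.ofNat n j) = 0) →
    Tf ε (fun s t => s < t) (fun t => if ∃ j, k < j ∧ j ≤ k + d + 1 ∧ n ∣ j then x t else 1)
      (Fin.ofNat n k) (Fin.ofNat n (k + d + 1)) v ∈ N := by
  induction d with
  | zero =>
    intro k _ _
    have h := hN (Fin.ofNat n (k + 1)) v hv
    rw [eWr_eq, ofNat_sub_one] at h
    convert h using 4
    rw [ofNat_eq_zero]
    constructor
    · rintro ⟨j, h1, h2, h3⟩
      have : j = k + 1 := by omega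
      rwa [this] at h3
    · intro h
      exact ⟨k + 1, by omega, by omega, h⟩
  | succ d ih =>
    intro k hd hz
    have h1 := ih (k + 1) (by omega) (fun j h1 h2 => hz j (by omega) (by omega))
    have h2 := hN (Fin.ofNat n (k + 1)) _ h1
    rw [eWr_eq, ofNat_sub_one, Tf_fusion ε (fun s t => s < t) (fun s => lt_irrefl s)] at h2
    · have e : k + 1 + d + 1 = k + (d + 1) + 1 := by ring
      rw [e] at h2
      convert h2 using 3 with t
      simp only [ofNat_eq_zero]
      by_cases c1 : n ∣ k + 1
      · have c2 : ¬ ∃ j, k + 1 < j ∧ j ≤ k + (d + 1) + 1 ∧ n ∣ j := by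
          rintro ⟨j, h1, h2, h3⟩
          have h4 := (Nat.dvd_sub h3 c1)
          have := Nat.le_of_dvd (by omega) h4
          omega
        rw [if_pos c1, if_neg c2, if_pos ⟨k + 1, by omega, by omega, c1⟩, mul_one]
      · rw [if_neg c1, one_mul]
        have c3 : (∃ j, k < j ∧ j ≤ k + (d + 1) + 1 ∧ n ∣ j) ↔
            ∃ j, k + 1 < j ∧ j ≤ k + (d + 1) + 1 ∧ n ∣ j := by
          constructor
          · rintro ⟨j, h1, h2, h3⟩
            refine ⟨j, ?_, h2, h3⟩
            by_contra h4
            have : j = k + 1 := by omega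
            rw [this] at h3
            exact c1 h3
          · rintro ⟨j, h1, h2, h3⟩
            exact ⟨j, by omega, h2, h3⟩
        simp only [c3]
    · exact ofNat_ne (by omega) (by omega)
    · exact ofNat_ne (by omega) (by omega)
    · exact ofNat_ne (by omega) (by omega)
    · exact hz (k + 1) (by omega) (by omega)

open Classical in
theorem pathF {n r : ℕ} [NeZero n] (ε : Fin n → Bool) (x : Fin r → K)
    (N : Submodule K (VrW n r)) (hN : ∀ i : Fin n, ∀ v ∈ N, fWr n r ε x i v ∈ N)
    (v : VrW n r) (hv : v ∈ N) (k d : ℕ) : d + 1 < n →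
    (∀ j, k < j → j < k + d + 1 → ∀ μ, v μ ≠ 0 → ∀ t, μ t (Fin.ofNat n j) = 0) →
    Tf ε (fun s t => t < s) (fun t => if ∃ j, k < j ∧ j ≤ k + d + 1 ∧ n ∣ j then (x t)⁻¹ else 1)
      (Fin.ofNat n (k + d + 1)) (Fin.ofNat n k) v ∈ N := by
  induction d with
  | zero =>
    intro hn _
    have h := hN (Fin.ofNat n (k + 1)) v hv
    rw [fWr_eq (by omega), ofNat_sub_one] at h
    convert h using 4
    rw [ofNat_eq_zero]
    constructor
    · rintro ⟨j, h1, h2, h3⟩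
      have : j = k + 1 := by omega
      rwa [this] at h3
    · intro h
      exact ⟨k + 1, by omega, by omega, h⟩
  | succ d ih =>
    intro hd hz
    have h1 := ih (by omega) (fun j h1 h2 => hz j (by omega) (by omega))
    have h2 := hN (Fin.ofNat n (k + (d + 1) + 1)) _ h1
    have e : k + (d + 1) = k + d + 1 := by ring
    rw [fWr_eq (by omega), ofNat_sub_one, e, Tf_fusion ε (fun s t => t < s) (fun s => lt_irrefl s)] at h2
    · rw [e]
      convert h2 using 3 with t
      simp only [ofNat_eq_zero]
      by_cases c1 : n ∣ k + d + 1 + 1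
      · have c2 : ¬ ∃ j, k < j ∧ j ≤ k + d + 1 ∧ n ∣ j := by
          rintro ⟨j, h1, h2, h3⟩
          have h4 := (Nat.dvd_sub c1 h3)
          have := Nat.le_of_dvd (by omega) h4
          omega
        rw [if_pos c1, if_neg c2, if_pos ⟨k + d + 1 + 1, by omega, by omega, c1⟩, mul_one]
      · rw [if_neg c1, one_mul]
        have c3 : (∃ j, k < j ∧ j ≤ k + d + 1 + 1 ∧ n ∣ j) ↔
            ∃ j, k < j ∧ j ≤ k + d + 1 ∧ n ∣ j := by
          constructor
          · rintro ⟨j, h1, h2, h3⟩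
            refine ⟨j, h1, ?_, h3⟩
            by_contra h4
            have : j = k + d + 1 + 1 := by omega
            rw [this] at h3
            exact c1 h3
          · rintro ⟨j, h1, h2, h3⟩
            exact ⟨j, h1, by omega, h3⟩
        simp only [c3]
    · exact (ofNat_ne (by omega) (by omega)).symm
    · exact (ofNat_ne (by omega) (by omega)).symm
    · exact (ofNat_ne (by omega) (by omega)).symm
    · exact hz (k + d + 1) (by omega) (by omega)

/-! ### Truncation -/

theorem fin_sub_one_val {M : ℕ} [NeZero M] (i : Fin M) :
    (i - 1).val = if i = 0 then M - 1 else i.val - 1 := by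
  cases M with
  | zero => exact i.elim0
  | succ m =>
    have := Fin.coe_sub_one i
    simpa using this

/-- data of consecutive even letters, in cyclic order, as natural numbers. -/
theorem consec {n M : ℕ} [NeZero n] [NeZero M] (hM : 2 ≤ M) (ε : Fin n → Bool)
    (φ : Fin M → Fin n) (hφ : StrictMono φ) (hsurj : ∀ p, ε p = false → ∃ i, φ i = p)
    (i : Fin M) :
    ∃ k d : ℕ, d + 1 < n ∧ Fin.ofNat n k = φ (i - 1) ∧ Fin.ofNat n (k + d + 1) = φ i ∧
      (∀ j, k < j → j < k + d + 1 → ε (Fin.ofNat n j) = true) ∧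
      ((∃ j, k < j ∧ j ≤ k + d + 1 ∧ n ∣ j) ↔ i = 0) := by
  have hlt : ∀ a b : Fin M, a.val < b.val ↔ (φ a).val < (φ b).val := fun a b =>
    (hφ.lt_iff_lt (a := a) (b := b)).symm
  have hs := fin_sub_one_val i
  have hbi := (φ i).isLt
  have hbp := (φ (i - 1)).isLt
  by_cases hi : i = 0
  · rw [if_pos hi] at hs
    have h0 : i.val = 0 := by rw [hi, Fin.val_zero]
    have h1 := (hlt i (i - 1)).1 (by omega)
    refine ⟨(φ (i - 1)).val, n + (φ i).val - (φ (i - 1)).val - 1, by omega, ?_, ?_, ?_, ?_⟩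
    · apply Fin.ext
      rw [Fin.val_ofNat, Nat.mod_eq_of_lt hbp]
    · apply Fin.ext
      rw [Fin.val_ofNat]
      have : (φ (i - 1)).val + (n + (φ i).val - (φ (i - 1)).val - 1) + 1 = (φ i).val + n := by omega
      rw [this, Nat.add_mod_right, Nat.mod_eq_of_lt hbi]
    · intro j h2 h3
      by_contra h4
      obtain ⟨m, hm⟩ := hsurj _ (Bool.eq_false_iff.2 h4)
      have h5 := congrArg Fin.val hm
      rw [Fin.val_ofNat] at h5
      have hmM := m.isLt
      by_cases hj : j < n
      · rw [Nat.mod_eq_of_lt hj] at h5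
        have := (hlt (i - 1) m).2 (by omega)
        omega
      · have e : j = (j - n) + n := by omega
        rw [e, Nat.add_mod_right, Nat.mod_eq_of_lt (by omega)] at h5
        have := (hlt m i).2 (by omega)
        omega
    · refine ⟨fun _ => hi, fun _ => ⟨n, hbp, by omega, dvd_refl n⟩⟩
  · rw [if_neg hi] at hs
    have h0 : i.val ≠ 0 := fun h => hi (Fin.ext (by rw [h, Fin.val_zero]))
    have h1 := (hlt (i - 1) i).1 (by omega)
    refine ⟨(φ (i - 1)).val, (φ i).val - (φ (i - 1)).val - 1, by omega, ?_, ?_, ?_, ?_⟩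
    · apply Fin.ext
      rw [Fin.val_ofNat, Nat.mod_eq_of_lt hbp]
    · apply Fin.ext
      rw [Fin.val_ofNat]
      have : (φ (i - 1)).val + ((φ i).val - (φ (i - 1)).val - 1) + 1 = (φ i).val := by omega
      rw [this, Nat.mod_eq_of_lt hbi]
    · intro j h2 h3
      by_contra h4
      obtain ⟨m, hm⟩ := hsurj _ (Bool.eq_false_iff.2 h4)
      have h5 := congrArg Fin.val hm
      rw [Fin.val_ofNat, Nat.mod_eq_of_lt (by omega)] at h5
      have h6 := (hlt (i - 1) m).2 (by omega)
      have h7 := (hlt m i).2 (by omega)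
      omega
    · refine ⟨?_, fun h => absurd h hi⟩
      rintro ⟨j, h2, h3, h4⟩
      have := Nat.le_of_dvd (by omega) h4
      omega

def TruncI {n r : ℕ} (ε : Fin n → Bool) (μ : Fin r → Fin n → ℕ) : Prop :=
  ∀ t p, ε p = true → μ t p = 0

open Classical in
/-- the embedding of functions on the truncated indices -/
def emb {n M r : ℕ} (ε : Fin n → Bool) (φ : Fin M → Fin n) : VrW M r →ₗ[K] VrW n r where
  toFun g := fun μ => if TruncI ε μ then g (fun t j => μ t (φ j)) else 0
  map_add' g h := by
    funext μ
    simp only [Pi.add_apply]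
    split_ifs <;> simp
  map_smul' c g := by
    funext μ
    simp only [Pi.smul_apply, RingHom.id_apply]
    split_ifs <;> simp

theorem emb_pos {n M r : ℕ} (ε : Fin n → Bool) (φ : Fin M → Fin n) (g : VrW M r)
    (μ : Fin r → Fin n → ℕ) (h : TruncI ε μ) : emb ε φ g μ = g (fun t j => μ t (φ j)) := by
  classical
  exact if_pos h

theorem emb_neg {n M r : ℕ} (ε : Fin n → Bool) (φ : Fin M → Fin n) (g : VrW M r)
    (μ : Fin r → Fin n → ℕ) (h : ¬ TruncI ε μ) : emb ε φ g μ = 0 := by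
  classical
  exact if_neg h

theorem emb_supp {n M r : ℕ} (ε : Fin n → Bool) (φ : Fin M → Fin n) (g : VrW M r)
    (μ : Fin r → Fin n → ℕ) (h : emb ε φ g μ ≠ 0) : TruncI ε μ := by
  by_contra h1
  exact h (emb_neg ε φ g μ h1)

/-- extension by zero of an index. -/
def extI {n M : ℕ} (φ : Fin M → Fin n) (m : Fin M → ℕ) (p : Fin n) : ℕ :=
  ∑ j, if φ j = p then m j else 0

theorem extI_apply {n M : ℕ} (φ : Fin M → Fin n) (hφ : Function.Injective φ) (m : Fin M → ℕ)
    (i : Fin M) : extI φ m (φ i) = m i := by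
  unfold extI
  simp [hφ.eq_iff]

theorem extI_odd {n M : ℕ} (ε : Fin n → Bool) (φ : Fin M → Fin n) (hε : ∀ j, ε (φ j) = false)
    (m : Fin M → ℕ) (p : Fin n) (hp : ε p = true) : extI φ m p = 0 := by
  unfold extI
  refine Finset.sum_eq_zero fun j _ => ?_
  rw [if_neg]
  rintro rfl
  rw [hε j] at hp
  exact absurd hp (by simp)

theorem emb_ext {n M r : ℕ} (ε : Fin n → Bool) (φ : Fin M → Fin n) (hφ : Function.Injective φ)
    (hε : ∀ j, ε (φ j) = false) (g : VrW M r) (ν : Fin r → Fin M → ℕ) :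
    emb ε φ g (fun t => extI φ (ν t)) = g ν := by
  rw [emb_pos _ _ _ _ (fun t p hp => extI_odd ε φ hε _ p hp)]
  congr 1
  funext t j
  exact extI_apply φ hφ _ _

theorem ext_trunc {n M r : ℕ} (ε : Fin n → Bool) (φ : Fin M → Fin n) (hφ : Function.Injective φ)
    (hε : ∀ j, ε (φ j) = false) (hsurj : ∀ p, ε p = false → ∃ i, φ i = p)
    (μ : Fin r → Fin n → ℕ) (h : TruncI ε μ) :
    (fun t => extI φ (fun j => μ t (φ j))) = μ := by
  funext t p
  by_cases hp : ε p = true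
  · rw [extI_odd ε φ hε _ p hp, h t p hp]
  · obtain ⟨i, rfl⟩ := hsurj p (Bool.eq_false_iff.2 hp)
    rw [extI_apply φ hφ]

theorem sum_trunc {n M : ℕ} {A : Type} [AddCommMonoid A] (ε : Fin n → Bool) (φ : Fin M → Fin n)
    (hφ : Function.Injective φ) (hsurj : ∀ p, ε p = false → ∃ i, φ i = p)
    (f : Fin n → A) (hf : ∀ p, ε p = true → f p = 0) : ∑ p, f p = ∑ j, f (φ j) := by
  rw [← Finset.sum_image (s := Finset.univ) (g := φ) (f := f) (fun a _ b _ h => hφ h)]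
  symm
  apply Finset.sum_subset (Finset.subset_univ _)
  intro p _ hp
  apply hf
  by_contra h
  obtain ⟨i, hi⟩ := hsurj p (Bool.eq_false_iff.2 h)
  exact hp (Finset.mem_image.2 ⟨i, Finset.mem_univ i, hi⟩)

theorem adm_trunc {n M r : ℕ} (ε : Fin n → Bool) (φ : Fin M → Fin n)
    (hφ : Function.Injective φ) (hsurj : ∀ p, ε p = false → ∃ i, φ i = p) (l : Fin r → ℕ)
    (μ : Fin r → Fin n → ℕ) (h : TruncI ε μ) :
    Adm ε l μ ↔ Adm (fun _ : Fin M => false) l (fun t j => μ t (φ j)) := by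
  unfold Adm
  refine forall_congr' fun t => ?_
  have h1 : ∑ p, μ t p = ∑ j, μ t (φ j) := sum_trunc ε φ hφ hsurj (μ t) (h t)
  constructor
  · rintro ⟨_, h2⟩
    exact ⟨fun p hp => absurd hp (by simp), by rw [← h1]; exact h2⟩
  · rintro ⟨_, h2⟩
    refine ⟨fun p hp => ?_, by rw [h1]; exact h2⟩
    rw [h t p hp]
    exact Nat.zero_le 1

theorem emb_Tf {n M r : ℕ} (ε : Fin n → Bool) (φ : Fin M → Fin n) (hφ : Function.Injective φ)
    (hε : ∀ j, ε (φ j) = false) (R : Fin r → Fin r → Prop) [DecidableRel R]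
    (X : Fin r → K) (a b : Fin M) (hab : a ≠ b) (g : VrW M r) :
    emb ε φ (Tf (fun _ => false) R X a b g) = Tf ε R X (φ a) (φ b) (emb ε φ g) := by
  have hab' : φ a ≠ φ b := fun h => hab (hφ h)
  have hq : ∀ j, qv ε (φ j) = qq := fun j => by simp [qv, hε j]
  funext μ
  by_cases h : TruncI ε μ
  · rw [emb_pos _ _ _ _ h]
    unfold Tf
    refine Finset.sum_congr rfl fun t _ => ?_
    have h1 : TruncI ε (Function.update μ t (mv (φ a) (φ b) (μ t))) := by
      intro s p hp
      have n1 : p ≠ φ a := by rintro rfl; rw [hε] at hp; exact absurd hp (by simp)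
      have n2 : p ≠ φ b := by rintro rfl; rw [hε] at hp; exact absurd hp (by simp)
      by_cases e : s = t
      · subst e
        rw [Function.update_self, mv_apply _ _ hab', if_neg n2, if_neg n1]
        exact h s p hp
      · rw [Function.update_of_ne e]
        exact h s p hp
    rw [emb_pos _ _ _ _ h1]
    congr 1
    · congr 1
      · refine Finset.prod_congr rfl fun s _ => ?_
        have hq' : ∀ j : Fin M, qv (fun _ : Fin M => false) j = qq := fun j => by simp [qv]
        simp only [kT, hq, hq']
      · simp [cT, hε]
    · congr 1
      funext s j
      by_cases e : s = t
      · subst e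
        simp only [Function.update_self, mv_apply _ _ hab', mv_apply _ _ hab, hφ.eq_iff]
      · simp only [Function.update_of_ne e]
  · rw [emb_neg _ _ _ _ h]
    by_contra hne
    obtain ⟨t, _, _, h3⟩ := Tf_ne (Ne.symm hne)
    apply h
    intro s p hp
    have h4 := emb_supp _ _ _ _ h3 s p hp
    have n1 : p ≠ φ a := by rintro rfl; rw [hε] at hp; exact absurd hp (by simp)
    have n2 : p ≠ φ b := by rintro rfl; rw [hε] at hp; exact absurd hp (by simp)
    by_cases e : s = t
    · subst e
      rw [Function.update_self, mv_apply _ _ hab', if_neg n2, if_neg n1] at h4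
      exact h4
    · rw [Function.update_of_ne e] at h4
      exact h4

theorem emb_qh {n M r : ℕ} (ε : Fin n → Bool) (φ : Fin M → Fin n) (hφ : Function.Injective φ)
    (hε : ∀ j, ε (φ j) = false) (hsurj : ∀ p, ε p = false → ∃ i, φ i = p)
    (h : Fin M → ℤ) (g : VrW M r) :
    ∃ h' : Fin n → ℤ, emb ε φ (qhWr M r (fun _ => false) h g) = qhWr n r ε h' (emb ε φ g) := by
  refine ⟨fun p => ∑ j, if φ j = p then h j else 0, ?_⟩
  funext μ
  by_cases hμ : TruncI ε μ
  · rw [emb_pos _ _ _ _ hμ]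
    simp only [qhWr, shift2, LinearMap.coe_mk, AddHom.coe_mk, id_eq, Pi.zero_apply, zero_mul,
      add_zero]
    rw [emb_pos _ _ _ _ hμ]
    congr 1
    refine Finset.prod_congr rfl fun t _ => ?_
    unfold qhW
    rw [← Finset.prod_subset (Finset.subset_univ (Finset.univ.image φ))]
    · rw [Finset.prod_image (fun a _ b _ h => hφ h)]
      refine Finset.prod_congr rfl fun j _ => ?_
      simp [qv, sgn, hε, hφ.eq_iff]
    · intro p _ hp
      have : ε p = true := by
        by_contra h
        obtain ⟨i, hi⟩ := hsurj p (Bool.eq_false_iff.2 h)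
        exact hp (Finset.mem_image.2 ⟨i, Finset.mem_univ i, hi⟩)
      rw [hμ t p this]
      simp
  · rw [emb_neg _ _ _ _ hμ]
    simp only [qhWr, shift2, LinearMap.coe_mk, AddHom.coe_mk, id_eq, Pi.zero_apply, zero_mul,
      add_zero]
    rw [emb_neg _ _ _ _ hμ, mul_zero]

theorem emb_mem_RSpan {n M r : ℕ} (ε : Fin n → Bool) (φ : Fin M → Fin n)
    (hφ : Function.Injective φ) (hε : ∀ j, ε (φ j) = false)
    (hsurj : ∀ p, ε p = false → ∃ i, φ i = p) (l : Fin r → ℕ) (g : VrW M r) :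
    emb ε φ g ∈ RSpan n r ε l ↔ g ∈ RSpan M r (fun _ => false) l := by
  rw [mem_RSpan, mem_RSpan]
  constructor
  · intro h ν hν
    have h1 := h (fun t => extI φ (ν t)) (by rwa [emb_ext ε φ hφ hε])
    rw [adm_trunc ε φ hφ hsurj l _ (fun t p hp => extI_odd ε φ hε _ p hp)] at h1
    convert h1 using 2 with t
    funext j
    exact (extI_apply φ hφ _ _).symm
  · intro h μ hμ
    have ht := emb_supp _ _ _ _ hμ
    rw [emb_pos _ _ _ _ ht] at hμ
    rw [adm_trunc ε φ hφ hsurj l _ ht]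
    exact h _ hμ

theorem emb_surj {n M r : ℕ} (ε : Fin n → Bool) (φ : Fin M → Fin n)
    (hφ : Function.Injective φ) (hε : ∀ j, ε (φ j) = false)
    (hsurj : ∀ p, ε p = false → ∃ i, φ i = p) (v : VrW n r) (hv : ∀ μ, v μ ≠ 0 → TruncI ε μ) :
    ∃ g : VrW M r, emb ε φ g = v := by
  refine ⟨fun ν => v (fun t => extI φ (ν t)), ?_⟩
  funext μ
  by_cases h : TruncI ε μ
  · rw [emb_pos _ _ _ _ h, ext_trunc ε φ hφ hε hsurj μ h]
  · rw [emb_neg _ _ _ _ h]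
    by_contra h1
    exact h (hv μ (Ne.symm h1))

theorem emb_inj {n M r : ℕ} (ε : Fin n → Bool) (φ : Fin M → Fin n)
    (hφ : Function.Injective φ) (hε : ∀ j, ε (φ j) = false) (g : VrW M r)
    (h : emb ε φ g = 0) : g = 0 := by
  funext ν
  rw [← emb_ext ε φ hφ hε g ν, h]
  rfl

theorem main_aux {n M r : ℕ} [NeZero n] [NeZero M] (l : Fin r → ℕ) (x : Fin r → K)
    (ε : Fin n → Bool) (hn : 2 ≤ n) (hM2 : 2 ≤ M) (hM : M = Mcount ε)
    (hl : ∑ t, l t ≤ Mcount ε)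
    (hirr : WtensorIrred M r (fun _ => false) l x) : WtensorIrred n r ε l x := by
  classical
  obtain ⟨φ, hmono, hε, hsurj⟩ : ∃ φ : Fin M → Fin n, StrictMono φ ∧ (∀ j, ε (φ j) = false) ∧
      (∀ p, ε p = false → ∃ i, φ i = p) := by
    let S : Finset (Fin n) := Finset.univ.filter fun p => ε p = false
    have hS : S.card = M := hM.symm
    refine ⟨S.orderEmbOfFin hS, (S.orderEmbOfFin hS).strictMono, fun j => ?_, fun p hp => ?_⟩
    · have := S.orderEmbOfFin_mem hS j
      exact (Finset.mem_filter.1 this).2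
    · have h1 : p ∈ Set.range (S.orderEmbOfFin hS) := by
        rw [Finset.range_orderEmbOfFin]
        simpa [S] using hp
      exact h1
  have hφ := hmono.injective
  obtain ⟨hne, hirr⟩ := hirr
  refine ⟨?_, ?_⟩
  · obtain ⟨g, hg, hg0⟩ := Submodule.exists_mem_ne_zero_of_ne_bot hne
    intro h
    have h1 := (emb_mem_RSpan ε φ hφ hε hsurj l g).2 hg
    rw [h, Submodule.mem_bot] at h1
    exact hg0 (emb_inj ε φ hφ hε g h1)
  · intro N hNR hNef hNq
    by_cases hN0 : N = ⊥
    · exact Or.inl hN0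
    right
    -- weights
    have hreach : ∀ μ : Fin r → Fin n → ℕ, Adm ε l μ →
        ∃ w', ReachW (fun p => ∑ t, μ t p) w' ∧ ∀ p, ε p = true → w' p = 0 := by
      intro μ hμ
      refine reach_stage1 ε _ _ ?_ rfl
      rw [Finset.sum_comm]
      rw [Finset.sum_congr rfl (fun t _ => (hμ t).2)]
      exact hl
    have htr : ∀ (w' : Fin n → ℕ), (∀ p, ε p = true → w' p = 0) → ∀ g : VrW n r,
        SuppW ε l w' g → ∀ μ, g μ ≠ 0 → TruncI ε μ := by
      intro w' hw' g hg μ hμ t p hp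
      have h1 := (hg μ hμ).2 p
      rw [hw' p hp, Finset.sum_eq_zero_iff] at h1
      exact h1 t (Finset.mem_univ t)
    -- the truncated submodule
    let N' : Submodule K (VrW M r) := N.comap (emb ε φ)
    have hzero : ∀ (g : VrW M r) (k d : ℕ),
        (∀ j, k < j → j < k + d + 1 → ε (Fin.ofNat n j) = true) →
        ∀ j, k < j → j < k + d + 1 → ∀ μ, emb ε φ g μ ≠ 0 → ∀ t, μ t (Fin.ofNat n j) = 0 :=
      fun g k d h j h1 h2 μ hμ t => emb_supp _ _ _ _ hμ t _ (h j h1 h2)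
    have hN'top : N' = RSpan M r (fun _ => false) l := by
      have hN'cases := hirr N' (fun g hg => (emb_mem_RSpan ε φ hφ hε hsurj l g).1 (hNR hg)) (by
          intro i g hg
          have hi := fin_sub_one_ne hM2 i
          obtain ⟨k, d, hd, hk, hk', hodd, hx⟩ := consec hM2 ε φ hmono hsurj i
          constructor
          · show emb ε φ (eWr M r (fun _ => false) x i g) ∈ N
            rw [eWr_eq, emb_Tf ε φ hφ hε _ _ _ _ hi]
            have h1 := pathE ε x N (fun i v hv => (hNef i v hv).1) _ hg d k hd
              (hzero g k d hodd)
            rw [hk, hk'] at h1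
            simpa only [hx] using h1
          · show emb ε φ (fWr M r (fun _ => false) x i g) ∈ N
            rw [fWr_eq hM2, emb_Tf ε φ hφ hε _ _ _ _ hi.symm]
            have h1 := pathF ε x N (fun i v hv => (hNef i v hv).2) _ hg k d hd
              (hzero g k d hodd)
            rw [hk, hk'] at h1
            simpa only [hx] using h1) (by
          intro h g hg
          obtain ⟨h', hh'⟩ := emb_qh ε φ hφ hε hsurj h g
          show emb ε φ (qhWr M r (fun _ => false) h g) ∈ N
          rw [hh']
          exact hNq h' _ hg)
      rcases hN'cases with h | h
      · exfalso
        obtain ⟨v, hv, hv0⟩ := Submodule.exists_mem_ne_zero_of_ne_bot hN0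
        obtain ⟨μ, hμ⟩ : ∃ μ, v μ ≠ 0 := by
          by_contra hcon
          push Not at hcon
          exact hv0 (funext hcon)
        have hadm := (mem_RSpan ε l v).1 (hNR hv)
        obtain ⟨w', hr, hw'⟩ := hreach μ (hadm μ hμ)
        obtain ⟨g, hgN, hg0, hgs⟩ := reach_exists hn ε x l N hNef _ w' hr
          ⟨_, weight_proj ε l N hNR hNq (fun p => ∑ t, μ t p) v hv, by
            intro h0
            have h1 := congrFun h0 μ
            unfold restr at h1
            rw [if_pos (show μ ∈ {ν : Fin r → Fin n → ℕ | ∀ p, ∑ t, ν t p = ∑ t, μ t p} from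
              fun p => rfl)] at h1
            exact hμ h1, by
            intro ν hν
            unfold restr at hν
            split_ifs at hν with h1
            · exact ⟨hadm ν hν, h1⟩
            · exact absurd rfl hν⟩
        obtain ⟨g', hg'⟩ := emb_surj ε φ hφ hε hsurj g (htr w' hw' g hgs)
        have h1 : g' ∈ N' := by
          show emb ε φ g' ∈ N
          rw [hg']
          exact hgN
        rw [h, Submodule.mem_bot] at h1
        apply hg0
        rw [← hg', h1, map_zero]
      · exact h
    apply le_antisymm hNR
    unfold RSpan
    rw [Submodule.span_le]
    rintro _ ⟨μ, hμ, rfl⟩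
    obtain ⟨w', hr, hw'⟩ := hreach μ hμ
    refine reach_all hn ε x l N hNef _ w' hr ?_ _ ?_
    · intro g hgs
      obtain ⟨g', rfl⟩ := emb_surj ε φ hφ hε hsurj g (htr w' hw' g hgs)
      have h1 : g' ∈ N' := by
        rw [hN'top, ← emb_mem_RSpan ε φ hφ hε hsurj l g', mem_RSpan]
        exact fun μ hμ => (hgs μ hμ).1
      exact h1
    · intro ν hν
      by_cases e : ν = μ
      · subst e
        exact ⟨hμ, fun p => rfl⟩
      · rw [Pi.single_eq_of_ne e] at hν
        exact absurd rfl hν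

/-- **Proposition 5.7 (Kwon–Yu)**: let `l₁,…,l_r ∈ ℤ_+` and `x₁,…,x_r ∈ ℚ(q)`, and let
`ε' = ε_{M|0} = (0^M)` consist of the zero entries of `ε`.  If `M` is sufficiently large and
`W_{l₁,ε'}(x₁) ⊗ ⋯ ⊗ W_{l_r,ε'}(x_r)` is irreducible, then
`W_{l₁,ε}(x₁) ⊗ ⋯ ⊗ W_{l_r,ε}(x_r)` is irreducible. -/
theorem irreducibility_from_truncation (r : ℕ) (l : Fin r → ℕ) (x : Fin r → K) :
    ∃ M₀ : ℕ, ∀ (n : ℕ) [NeZero n] (ε : Fin n → Bool), 4 ≤ n → M₀ ≤ Mcount ε →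
      ∀ (M : ℕ) [NeZero M], M = Mcount ε →
        WtensorIrred M r (fun _ => false) l x → WtensorIrred n r ε l x := by

  refine ⟨∑ t, l t + 2, ?_⟩
  intro n _ ε hn hM₀ M _ hM hirr
  exact main_aux l x ε (by omega) (by omega) hM (by omega) hirr
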